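/- Let n ≥ 1 and 0 < p < 1, and let m be a sufficiently large integer (m > n/p). There exists a constant C > 0 such that for every R > 0 and every f ∈ H^p(ℝ^n) ∩ L¹(ℝ^n) supported in the closed ball B̄(0,R), the grand maximal function satisfies M_m f(x) ≤ C R^{-n/p} ‖f‖_{H^p(ℝ^n)} for every x with |x| > CR. -/

import Mathlib

open MeasureTheory Metric Filter

noncomputable section

/-- Euclidean space `ℝⁿ`. -/
abbrev E (n : ℕ) := EuclideanSpace ℝ (Fin n)

/-- The class `A_m`: Schwartz functions `φ` with
`sup_{|β| ≤ m} sup_x (1+|x|)^m |D^β φ(x)| ≤ 1`. -/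
def MemAm (n m : ℕ) (φ : SchwartzMap (E n) ℝ) : Prop :=
  ∀ k ≤ m, ∀ x : E n, (1 + ‖x‖) ^ m * ‖iteratedFDeriv ℝ k (φ : E n → ℝ) x‖ ≤ 1

/-- The dilated convolution `φ_t * f (x) = ∫ t⁻ⁿ φ((x-y)/t) f(y) dy`. -/
def dilConv (n : ℕ) (φ : SchwartzMap (E n) ℝ) (t : ℝ) (f : E n → ℝ) (x : E n) : ℝ :=
  ∫ y, (t ^ n)⁻¹ * φ (t⁻¹ • (x - y)) * f y

/-- The grand maximal function `M_m f(x) = sup_{φ ∈ A_m} sup_{t > 0} |φ_t * f(x)|`. -/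
def grandMaximal (n m : ℕ) (f : E n → ℝ) (x : E n) : ℝ :=
  sSup { c : ℝ | ∃ φ : SchwartzMap (E n) ℝ, MemAm n m φ ∧
    ∃ t : ℝ, 0 < t ∧ c = |dilConv n φ t f x| }

/-- The `H^p` quasinorm, via the maximal characterisation:
`‖f‖_{H^p} = ‖M_m f‖_{L^p} = (∫ (M_m f)^p)^{1/p}`. -/
def HpMaxNorm (n m : ℕ) (p : ℝ) (f : E n → ℝ) : ℝ :=
  (∫ x, grandMaximal n m f x ^ p) ^ (1 / p)

/-- At almost every point the Hardy–Littlewood averages of an integrable function are bounded. -/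
lemma ae_exists_setIntegral_closedBall_le {n : ℕ} {f : E n → ℝ} (hf : Integrable f) :
    ∀ᵐ z : E n, ∃ A : ℝ, 0 ≤ A ∧ ∀ r : ℝ, 0 < r → ∫ y in closedBall z r, ‖f y‖ ≤ A * r ^ n := by
  filter_upwards [IsUnifLocDoublingMeasure.ae_tendsto_average (μ := (volume : Measure (E n)))
    hf.norm.locallyIntegrable 1] with z hz
  have hlim := hz (l := nhdsWithin (0 : ℝ) (Set.Ioi 0)) (fun _ => z) id tendsto_id
    (by filter_upwards [self_mem_nhdsWithin] with r hr
        exact mem_closedBall_self (by simpa using le_of_lt hr))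
  have hev := hlim.eventually (gt_mem_nhds (lt_add_one ‖f z‖))
  obtain ⟨r₀, hr₀, hball⟩ := mem_nhdsGT_iff_exists_Ioo_subset.1 hev
  have hr₀ : 0 < r₀ := hr₀
  set v : ℝ := (volume : Measure (E n)).real (ball 0 1) with hv
  have hvol (r : ℝ) (hr : 0 < r) : (volume : Measure (E n)).real (closedBall z r) = r ^ n * v := by
    rw [measureReal_def, Measure.addHaar_closedBall _ _ hr.le, ENNReal.toReal_mul,
      ENNReal.toReal_ofReal (by positivity), hv, measureReal_def]
    simp
  have hv0 : 0 < v := ENNReal.toReal_pos (measure_ball_pos _ _ one_pos).ne' measure_ball_lt_top.ne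
  refine ⟨(‖f z‖ + 1) * v + (∫ y, ‖f y‖) / r₀ ^ n, by positivity, fun r hr => ?_⟩
  have hI : 0 ≤ ∫ y, ‖f y‖ := by positivity
  rw [add_mul]
  rcases lt_or_ge r r₀ with h | h
  · have := hball (show r ∈ Set.Ioo 0 r₀ from ⟨hr, h⟩)
    simp only [Set.mem_ofPred_eq, id, setAverage_eq, smul_eq_mul, hvol r hr] at this
    rw [inv_mul_lt_iff₀ (by positivity)] at this
    have h2 : 0 ≤ (∫ y, ‖f y‖) / r₀ ^ n * r ^ n := by positivity
    nlinarith
  · have h1 : ∫ y in closedBall z r, ‖f y‖ ≤ ∫ y, ‖f y‖ :=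
      setIntegral_le_integral hf.norm (Eventually.of_forall fun _ => norm_nonneg _)
    have h2 : ∫ y, ‖f y‖ ≤ (∫ y, ‖f y‖) / r₀ ^ n * r ^ n := by
      rw [div_mul_eq_mul_div, le_div_iff₀ (by positivity)]
      gcongr
    have h3 : 0 ≤ (‖f z‖ + 1) * v * r ^ n := by positivity
    linarith

/-- Dyadic domination of a polynomially decaying kernel by indicators of dyadic intervals. -/
lemma exists_nat_one_add_pow_inv_le (m : ℕ) {ρ : ℝ} (hρ : 0 ≤ ρ) :
    ∃ k : ℕ, ρ ≤ 2 ^ k ∧ ((1 + ρ) ^ m)⁻¹ ≤ 2 ^ m * ((2 ^ k) ^ m)⁻¹ := by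
  have hex : ∃ k : ℕ, ρ ≤ 2 ^ k := (pow_unbounded_of_one_lt ρ one_lt_two).imp fun _ h => h.le
  refine ⟨Nat.find hex, Nat.find_spec hex, ?_⟩
  have hle : (2 : ℝ) ^ Nat.find hex ≤ 2 * (1 + ρ) := by
    rcases Nat.eq_zero_or_pos (Nat.find hex) with h0 | h0
    · rw [h0]; linarith
    · have := Nat.find_min hex (Nat.sub_lt h0 one_pos)
      rw [not_le] at this
      obtain ⟨j, hj⟩ := Nat.exists_eq_succ_of_ne_zero h0.ne'
      rw [hj] at this ⊢
      simp only [Nat.succ_eq_add_one, Nat.add_sub_cancel] at this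
      rw [Nat.succ_eq_add_one, pow_succ]
      linarith
  rw [← div_eq_mul_inv, inv_le_comm₀ (by positivity) (by positivity), inv_div,
    div_le_iff₀ (by positivity), ← mul_pow]
  gcongr
  linarith

lemma MemAm.abs_le {n m : ℕ} {φ : SchwartzMap (E n) ℝ} (hφ : MemAm n m φ) (x : E n) :
    |φ x| ≤ ((1 + ‖x‖) ^ m)⁻¹ := by
  have := hφ 0 (Nat.zero_le _) x
  rw [norm_iteratedFDeriv_zero, Real.norm_eq_abs] at this
  rwa [← one_div, le_div_iff₀' (by positivity)]

/-- If the averages of `f` over balls centred at `z` are bounded, so are the `A_m`-means. -/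
lemma abs_dilConv_le {n m : ℕ} (hm : n < m) {f : E n → ℝ} (hf : Integrable f) {z : E n} {A : ℝ}
    (hA0 : 0 ≤ A) (hA : ∀ r : ℝ, 0 < r → ∫ y in closedBall z r, ‖f y‖ ≤ A * r ^ n)
    {φ : SchwartzMap (E n) ℝ} (hφ : MemAm n m φ) {t : ℝ} (ht : 0 < t) :
    |dilConv n φ t f z| ≤ 2 ^ m * A * 2 := by
  have hpt (y : E n) : ‖(t ^ n)⁻¹ * φ (t⁻¹ • (z - y)) * f y‖ₑ ≤
      ∑' k : ℕ, (closedBall z (t * 2 ^ k)).indicator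
        (fun y => ENNReal.ofReal ((t ^ n)⁻¹ * (2 ^ m * ((2 ^ k) ^ m)⁻¹)) * ‖f y‖ₑ) y := by
    obtain ⟨k, hk, hk'⟩ := exists_nat_one_add_pow_inv_le m (norm_nonneg (t⁻¹ • (z - y)))
    refine le_trans ?_ (ENNReal.le_tsum k)
    have hy : y ∈ closedBall z (t * 2 ^ k) := by
      rw [norm_smul, norm_inv, Real.norm_of_nonneg ht.le, inv_mul_le_iff₀ ht] at hk
      rwa [mem_closedBall, dist_comm, dist_eq_norm]
    rw [Set.indicator_of_mem hy, enorm_mul]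
    gcongr
    rw [← ofReal_norm, norm_mul, Real.norm_of_nonneg (by positivity), Real.norm_eq_abs]
    gcongr
    exact (hφ.abs_le _).trans hk'
  have hterm (k : ℕ) : ∫⁻ y, (closedBall z (t * 2 ^ k)).indicator
        (fun y => ENNReal.ofReal ((t ^ n)⁻¹ * (2 ^ m * ((2 ^ k) ^ m)⁻¹)) * ‖f y‖ₑ) y ≤
      ENNReal.ofReal (2 ^ m * A) * 2⁻¹ ^ k := by
    rw [lintegral_indicator measurableSet_closedBall,
      lintegral_const_mul' _ _ ENNReal.ofReal_ne_top,
      ← ofReal_integral_norm_eq_lintegral_enorm hf.integrableOn,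
      ← ENNReal.ofReal_mul (by positivity)]
    have h2 : (2⁻¹ : ENNReal) ^ k = ENNReal.ofReal (2⁻¹ ^ k) := by
      rw [ENNReal.ofReal_pow (by norm_num), ENNReal.ofReal_inv_of_pos two_pos,
        ENNReal.ofReal_ofNat]
    rw [h2, ← ENNReal.ofReal_mul (by positivity)]
    apply ENNReal.ofReal_le_ofReal
    have h3 : ((2 : ℝ) ^ k) ^ n * ((2 ^ k) ^ m)⁻¹ ≤ 2⁻¹ ^ k := by
      rw [← div_eq_mul_inv, div_le_iff₀ (by positivity), inv_pow, ← div_eq_inv_mul,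
        le_div_iff₀ (by positivity), ← pow_succ]
      exact pow_le_pow_right₀ (one_le_pow₀ one_le_two) hm
    calc (t ^ n)⁻¹ * (2 ^ m * ((2 ^ k) ^ m)⁻¹) * ∫ y in closedBall z (t * 2 ^ k), ‖f y‖
        ≤ (t ^ n)⁻¹ * (2 ^ m * ((2 ^ k) ^ m)⁻¹) * (A * (t * 2 ^ k) ^ n) := by
          gcongr
          exact hA _ (by positivity)
      _ = 2 ^ m * A * ((2 ^ k) ^ n * ((2 ^ k) ^ m)⁻¹) := by
          rw [mul_pow]; field_simp
      _ ≤ _ := by gcongr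
  have hmain : ‖dilConv n φ t f z‖ₑ ≤ ENNReal.ofReal (2 ^ m * A * 2) := by
    calc ‖dilConv n φ t f z‖ₑ ≤ ∫⁻ y, ‖(t ^ n)⁻¹ * φ (t⁻¹ • (z - y)) * f y‖ₑ :=
          enorm_integral_le_lintegral_enorm _
      _ ≤ _ := lintegral_mono hpt
      _ = _ := lintegral_tsum fun k =>
          (hf.1.enorm.const_mul _).indicator measurableSet_closedBall
      _ ≤ _ := ENNReal.tsum_le_tsum hterm
      _ = _ := by
          rw [ENNReal.tsum_mul_left, ENNReal.tsum_geometric, ENNReal.one_sub_inv_two, inv_inv,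
            ENNReal.ofReal_mul (p := 2 ^ m * A) (by positivity), ENNReal.ofReal_ofNat]
  rw [← ofReal_norm, ENNReal.ofReal_le_ofReal_iff (by positivity)] at hmain
  exact hmain

/-- For integrable `f` the supremum defining `M_m f` is finite almost everywhere. -/
lemma ae_abs_dilConv_le_grandMaximal {n m : ℕ} (hm : n < m) {f : E n → ℝ} (hf : Integrable f) :
    ∀ᵐ z : E n, ∀ φ : SchwartzMap (E n) ℝ, MemAm n m φ → ∀ t : ℝ, 0 < t →
      |dilConv n φ t f z| ≤ grandMaximal n m f z := by
  filter_upwards [ae_exists_setIntegral_closedBall_le hf] with z ⟨A, hA0, hA⟩ φ hφ t ht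
  refine le_csSup ⟨2 ^ m * A * 2, ?_⟩ ⟨φ, hφ, t, ht, rfl⟩
  rintro _ ⟨ψ, hψ, s, hs, rfl⟩
  exact abs_dilConv_le hm hf hA0 hA hψ hs

lemma grandMaximal_nonneg (n m : ℕ) (f : E n → ℝ) (x : E n) : 0 ≤ grandMaximal n m f x := by
  apply Real.sSup_nonneg
  rintro _ ⟨φ, -, t, -, rfl⟩
  exact abs_nonneg _

/-- Localising an element of `A_m` by a bump function gives a multiple of an element of `A_m`. -/
lemma MemAm.exists_localization {n m : ℕ} {φ : SchwartzMap (E n) ℝ} (hφ : MemAm n m φ)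
    (η : ContDiffBump (0 : E n)) (hη : η.rOut = 1) {H : ℝ} (hH : 0 < H)
    (hηH : ∀ j ≤ m, ∀ u, ‖iteratedFDeriv ℝ j η u‖ ≤ H)
    {a q : E n} {b κ : ℝ} (hb0 : 0 ≤ b) (hb1 : b ≤ 1) (hq : ‖q‖ ≤ 1) (hκ : 0 < κ)
    (hfar : ∀ u : E n, ‖u - q‖ ≤ 1 → ((1 + ‖a + b • u‖) ^ m)⁻¹ ≤ κ) :
    ∃ ψ : SchwartzMap (E n) ℝ, MemAm n m ψ ∧
      ∀ u, φ (a + b • u) * η (u - q) = 3 ^ m * 2 ^ m * H * κ * ψ u := by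
  have hL : 0 < 3 ^ m * 2 ^ m * H * κ := by positivity
  have hφs : ContDiff ℝ (⊤ : ℕ∞) (fun u : E n => φ (a + b • u)) :=
    (φ.smooth ⊤).comp (by fun_prop)
  have hηs : ContDiff ℝ (⊤ : ℕ∞) (fun u : E n => η (u - q)) :=
    η.contDiff.comp (by fun_prop)
  have hprod : ContDiff ℝ (⊤ : ℕ∞) (fun u : E n => φ (a + b • u) * η (u - q)) := hφs.mul hηs
  have hcs : HasCompactSupport (fun u : E n => φ (a + b • u) * η (u - q)) :=
    (η.hasCompactSupport.comp_homeomorph (Homeomorph.subRight q)).mul_left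
  refine ⟨(3 ^ m * 2 ^ m * H * κ)⁻¹ • hcs.toSchwartzMap hprod, fun k hk u => ?_, fun u => ?_⟩
  swap
  · simp only [smul_apply, HasCompactSupport.toSchwartzMap_toFun, smul_eq_mul]
    field_simp
  have hcoe : ((((3 ^ m * 2 ^ m * H * κ)⁻¹ • hcs.toSchwartzMap hprod : SchwartzMap (E n) ℝ)) :
      E n → ℝ) = (3 ^ m * 2 ^ m * H * κ)⁻¹ • fun u : E n => φ (a + b • u) * η (u - q) := by
    ext u
    simp
  rw [hcoe, iteratedFDeriv_const_smul_apply (hprod.contDiffAt.of_le (mod_cast le_top)), norm_smul,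
    Real.norm_of_nonneg (by positivity), mul_left_comm, inv_mul_le_iff₀ hL, mul_one]
  have hηd (j : ℕ) :
      iteratedFDeriv ℝ j (fun u : E n => η (u - q)) u = iteratedFDeriv ℝ j η (u - q) :=
    iteratedFDeriv_comp_sub j q u
  have hφd (i : ℕ) : ‖iteratedFDeriv ℝ i (fun u : E n => φ (a + b • u)) u‖ ≤
      ‖iteratedFDeriv ℝ i (φ : E n → ℝ) (a + b • u)‖ := by
    rw [iteratedFDeriv_comp_const_smul (f := fun z => φ (a + z)) b
      ((φ.smooth i).comp (by fun_prop)), norm_smul, iteratedFDeriv_comp_add_left]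
    refine mul_le_of_le_one_left (norm_nonneg _) ?_
    rw [norm_pow, Real.norm_of_nonneg hb0]
    exact pow_le_one₀ hb0 hb1
  have hleib := norm_iteratedFDeriv_mul_le hφs hηs u (n := k) (mod_cast le_top)
  by_cases hu : ‖u - q‖ ≤ 1
  · have hu3 : (1 + ‖u‖) ^ m ≤ 3 ^ m := by
      gcongr
      have := norm_add_le (u - q) q
      rw [sub_add_cancel] at this
      linarith
    have hterm : ∀ i ∈ Finset.range (k + 1),
        (k.choose i : ℝ) * ‖iteratedFDeriv ℝ i (fun u : E n => φ (a + b • u)) u‖ *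
          ‖iteratedFDeriv ℝ (k - i) (fun u : E n => η (u - q)) u‖ ≤ (k.choose i : ℝ) * (κ * H) := by
      intro i hi
      have hik : i ≤ k := Nat.lt_succ_iff.1 (Finset.mem_range.1 hi)
      rw [mul_assoc, hηd]
      gcongr
      · refine (hφd i).trans (le_trans ?_ (hfar u hu))
        rw [← one_div, le_div_iff₀' (by positivity)]
        exact hφ i (hik.trans hk) _
      · exact hηH _ ((Nat.sub_le _ _).trans hk) _
    have hsum := hleib.trans (Finset.sum_le_sum hterm)
    rw [← Finset.sum_mul, ← Nat.cast_sum, Nat.sum_range_choose] at hsum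
    calc _ ≤ 3 ^ m * (((2 ^ k : ℕ) : ℝ) * (κ * H)) := by gcongr
      _ ≤ 3 ^ m * (2 ^ m * (κ * H)) := by
          push_cast
          gcongr
          norm_num
      _ = _ := by ring
  · have hzero : ∀ j, iteratedFDeriv ℝ j (fun u : E n => η (u - q)) u = 0 := by
      intro j
      rw [hηd]
      by_contra hne
      have := support_iteratedFDeriv_subset j (𝕜 := ℝ) (f := η) hne
      rw [η.tsupport_eq, hη, mem_closedBall_zero_iff] at this
      exact hu this
    simp only [hzero, norm_zero, mul_zero, Finset.sum_const_zero] at hleib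
    rw [le_antisymm hleib (norm_nonneg _), mul_zero]
    exact hL.le

lemma ContDiffBump.eq_zero_of_rOut_le_norm {n : ℕ} (η : ContDiffBump (0 : E n)) {u : E n}
    (hu : η.rOut ≤ ‖u‖) : η u = 0 :=
  η.zero_of_le_dist (by rwa [dist_zero_right])

/-- Far from the support of `f`, a localised mean of `f` is controlled by nearby values of the
grand maximal function. -/
lemma abs_integral_localized_le {n m : ℕ} {φ : SchwartzMap (E n) ℝ} (hφ : MemAm n m φ)
    (η : ContDiffBump (0 : E n)) (hη : η.rOut = 1) {H : ℝ} (hH : 0 < H)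
    (hηH : ∀ j ≤ m, ∀ u, ‖iteratedFDeriv ℝ j η u‖ ≤ H)
    {R t : ℝ} (hR : 0 < R) (ht : 0 < t) {f : E n → ℝ}
    (hsupp : ∀ y, y ∉ closedBall (0 : E n) R → f y = 0) {x : E n} (hx : 4 * R < ‖x‖)
    {w z : E n} (hzw : ‖z - w‖ ≤ min t R)
    (hz : ∀ ψ : SchwartzMap (E n) ℝ, MemAm n m ψ → ∀ s : ℝ, 0 < s →
      |dilConv n ψ s f z| ≤ grandMaximal n m f z) :
    |∫ y, φ (t⁻¹ • (x - y)) * f y * η ((min t R)⁻¹ • (w - y))| ≤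
      3 ^ m * 2 ^ m * H * (min t R / R) ^ m * (min t R) ^ n * grandMaximal n m f z := by
  set s := min t R with hs
  have hs0 : 0 < s := lt_min ht hR
  have hsR : s ≤ R := min_le_right _ _
  have hst : s ≤ t := min_le_left _ _
  by_cases hw : ‖w‖ ≤ 2 * R
  · obtain ⟨ψ, hψ, hψe⟩ := hφ.exists_localization η hη hH hηH (a := t⁻¹ • (x - z))
      (q := s⁻¹ • (z - w)) (b := s / t) (κ := (s / R) ^ m) (by positivity)
      ((div_le_one ht).2 hst)
      (by rwa [norm_smul, norm_inv, Real.norm_of_nonneg hs0.le, inv_mul_le_iff₀ hs0, mul_one])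
      (by positivity) (fun u hu => by
        have hyw : ‖w - (z - s • u)‖ ≤ s := by
          have : w - (z - s • u) = s • (u - s⁻¹ • (z - w)) := by
            rw [smul_sub, smul_inv_smul₀ hs0.ne']
            abel
          rw [this, norm_smul, Real.norm_of_nonneg hs0.le]
          exact mul_le_of_le_one_right hs0.le hu
        have hxy : R ≤ ‖x - (z - s • u)‖ := by
          have h1 := norm_le_norm_add_norm_sub' x (z - s • u)
          have h2 := norm_le_norm_add_norm_sub w (z - s • u)
          linarith
        have he : t⁻¹ • (x - z) + (s / t) • u = t⁻¹ • (x - (z - s • u)) := by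
          rw [div_eq_inv_mul, mul_smul, ← smul_add]
          congr 1
          abel
        rw [he, norm_smul, norm_inv, Real.norm_of_nonneg ht.le, ← inv_pow]
        gcongr
        rw [inv_le_comm₀ (by positivity) (by positivity), inv_div, div_le_iff₀ hs0]
        generalize ‖x - (z - s • u)‖ = Y at hxy ⊢
        rcases le_total t R with h | h
        · rw [hs, min_eq_left h, add_mul, mul_right_comm, inv_mul_cancel₀ ht.ne']
          linarith
        · rw [hs, min_eq_right h]
          have hY : 0 ≤ Y := hR.le.trans hxy
          exact le_mul_of_one_le_left hR.le (le_add_of_nonneg_right (by positivity)))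
    have hint : ∫ y, φ (t⁻¹ • (x - y)) * f y * η (s⁻¹ • (w - y)) =
        3 ^ m * 2 ^ m * H * (s / R) ^ m * s ^ n * dilConv n ψ s f z := by
      rw [dilConv, ← integral_const_mul]
      congr 1 with y
      have h := hψe (s⁻¹ • (z - y))
      have e1 : t⁻¹ • (x - z) + (s / t) • s⁻¹ • (z - y) = t⁻¹ • (x - y) := by
        rw [smul_smul, div_eq_inv_mul, mul_assoc, mul_inv_cancel₀ hs0.ne', mul_one, ← smul_add]
        congr 1
        abel
      have e2 : s⁻¹ • (z - y) - s⁻¹ • (z - w) = s⁻¹ • (w - y) := by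
        rw [← smul_sub]
        congr 1
        abel
      rw [e1, e2] at h
      rw [mul_right_comm, h]
      field_simp
    rw [hint, abs_mul, abs_of_nonneg (by positivity)]
    gcongr
    exact hz ψ hψ s hs0
  · have hint : ∫ y, φ (t⁻¹ • (x - y)) * f y * η (s⁻¹ • (w - y)) = 0 := by
      rw [← integral_zero (E n) ℝ]
      congr 1 with y
      by_cases hy : y ∈ closedBall (0 : E n) R
      · rw [η.eq_zero_of_rOut_le_norm, mul_zero]
        rw [mem_closedBall_zero_iff] at hy
        rw [hη, norm_smul, norm_inv, Real.norm_of_nonneg hs0.le, le_inv_mul_iff₀ hs0, mul_one]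
        have := norm_le_norm_add_norm_sub' w y
        linarith
      · rw [hsupp y hy, mul_zero, zero_mul]
    rw [hint, abs_zero]
    have := grandMaximal_nonneg n m f z
    positivity

/-- If `c w` is dominated by `g` on the ball of radius `s` around `w`, then the `L¹` norm of `c`
is controlled by the `L^p` quasinorm of `g`, for `p ≤ 1`. -/
lemma integral_le_of_le_on_closedBall {n : ℕ} {p s : ℝ} (hp0 : 0 < p) (hp1 : p < 1) (hs : 0 < s)
    {c g : E n → ℝ} (hc : ∀ w, 0 ≤ c w) (hg : ∀ z, 0 ≤ g z) (hgp : Integrable fun z => g z ^ p)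
    (hcg : ∀ᵐ z : E n, ∀ w, ‖z - w‖ ≤ s → c w ≤ g z) :
    ∫ w, c w ≤ ((∫ z, g z ^ p) / (s ^ n * (volume : Measure (E n)).real (ball 0 1))) ^ (1 / p - 1) *
      ∫ z, g z ^ p := by
  set v := (volume : Measure (E n)).real (ball 0 1) with hv
  set N := ∫ z, g z ^ p with hN
  have hv0 : 0 < v := ENNReal.toReal_pos (measure_ball_pos _ _ one_pos).ne' measure_ball_lt_top.ne
  have hcw (w : E n) : c w ^ p ≤ N / (s ^ n * v) := by
    rw [le_div_iff₀ (by positivity)]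
    have hvol : (volume : Measure (E n)).real (closedBall w s) = s ^ n * v := by
      rw [measureReal_def, Measure.addHaar_closedBall _ _ hs.le, ENNReal.toReal_mul,
        ENNReal.toReal_ofReal (by positivity), hv, measureReal_def]
      simp
    calc c w ^ p * (s ^ n * v) = ∫ _ in closedBall w s, c w ^ p := by
          rw [setIntegral_const, hvol, smul_eq_mul, mul_comm]
      _ ≤ ∫ z in closedBall w s, g z ^ p := by
          refine setIntegral_mono_on_ae
            (integrableOn_const (measure_closedBall_lt_top.ne) (by simp))
            hgp.integrableOn measurableSet_closedBall ?_
          filter_upwards [hcg] with z hz hzw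
          rw [mem_closedBall, dist_eq_norm] at hzw
          exact Real.rpow_le_rpow (hc w) (hz w hzw) hp0.le
      _ ≤ N := setIntegral_le_integral hgp
          (Eventually.of_forall fun z => Real.rpow_nonneg (hg z) p)
  rw [← integral_const_mul]
  refine integral_mono_of_nonneg (Eventually.of_forall hc) (hgp.const_mul _) ?_
  filter_upwards [hcg] with w hw
  have hcgw : c w ≤ g w := hw w (by simpa using hs.le)
  have h1p : 0 ≤ 1 / p - 1 := by
    rw [sub_nonneg, le_div_iff₀ hp0]
    linarith
  rcases (hc w).eq_or_lt with h0 | h0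
  · rw [← h0]
    have := hg w
    have := (Real.rpow_nonneg (hc w) p).trans (hcw w)
    positivity
  calc c w = (c w ^ p) ^ (1 / p - 1) * c w ^ p := by
        rw [← Real.rpow_mul h0.le, ← Real.rpow_add h0,
          show p * (1 / p - 1) + p = 1 by field_simp; ring, Real.rpow_one]
    _ ≤ (N / (s ^ n * v)) ^ (1 / p - 1) * c w ^ p := by
        have := Real.rpow_nonneg (hc w) p
        exact mul_le_mul_of_nonneg_right (Real.rpow_le_rpow this (hcw w) h1p) this
    _ ≤ _ := mul_le_mul_of_nonneg_left (Real.rpow_le_rpow h0.le hcgw hp0.le)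
        (Real.rpow_nonneg ((Real.rpow_nonneg (hc w) p).trans (hcw w)) _)

lemma integrable_dilation_mul {n : ℕ} (φ : SchwartzMap (E n) ℝ) (t : ℝ) {f : E n → ℝ}
    (hf : Integrable f) (x : E n) : Integrable fun y => φ (t⁻¹ • (x - y)) * f y := by
  obtain ⟨B, -, hB⟩ := φ.decay 0 0
  refine hf.bdd_mul (c := B) ?_ (Eventually.of_forall fun y => ?_)
  · exact (φ.continuous.comp (by fun_prop)).aestronglyMeasurable
  · simpa using hB (t⁻¹ • (x - y))

/-- Averaging the localised means over all positions of the bump recovers the mean itself. -/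
lemma abs_integral_mul_le_integral_abs_localized {n : ℕ} (φ : SchwartzMap (E n) ℝ)
    (η : ContDiffBump (0 : E n)) {t s : ℝ} (hs : 0 < s) {f : E n → ℝ}
    (hf : Integrable f) (x : E n) :
    |∫ y, φ (t⁻¹ • (x - y)) * f y| * (s ^ n * ∫ u, η u) ≤
      ∫ w, |∫ y, φ (t⁻¹ • (x - y)) * f y * η (s⁻¹ • (w - y))| := by
  have hηi : Integrable (fun u : E n => η (s⁻¹ • u)) :=
    η.integrable.comp_smul (inv_ne_zero hs.ne')
  have hconv := integral_convolution (μ := (volume : Measure (E n))) (ν := volume)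
    (ContinuousLinearMap.mul ℝ ℝ) (integrable_dilation_mul φ t hf x) hηi
  simp only [convolution_def, ContinuousLinearMap.mul_apply'] at hconv
  rw [Measure.integral_comp_inv_smul_of_nonneg _ _ hs.le] at hconv
  have hη0 : 0 ≤ ∫ u, η u := integral_nonneg fun _ => η.nonneg
  calc _ = |∫ w, ∫ y, φ (t⁻¹ • (x - y)) * f y * η (s⁻¹ • (w - y))| := by
        rw [hconv, abs_mul, smul_eq_mul, finrank_euclideanSpace_fin,
          abs_of_nonneg (a := s ^ n * _) (by positivity)]
    _ ≤ _ := abs_integral_le_integral_abs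

lemma exists_bound_iteratedFDeriv {n : ℕ} (η : ContDiffBump (0 : E n)) (m : ℕ) :
    ∃ H : ℝ, 0 < H ∧ ∀ j ≤ m, ∀ u, ‖iteratedFDeriv ℝ j η u‖ ≤ H := by
  choose B hB0 hB using fun j => (η.hasCompactSupport.toSchwartzMap η.contDiff).decay 0 j
  refine ⟨∑ j ∈ Finset.range (m + 1), B j, Finset.sum_pos (fun j _ => hB0 j) (by simp),
    fun j hj u => ?_⟩
  have hBj : ‖iteratedFDeriv ℝ j (η.hasCompactSupport.toSchwartzMap η.contDiff) u‖ ≤ B j := by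
    simpa using hB j u
  exact hBj.trans (Finset.single_le_sum (f := B) (fun i _ => (hB0 i).le)
    (Finset.mem_range.2 (Nat.lt_succ_of_le hj)))

/-- Each `A_m`-mean far away from the support of `f` is controlled by the `H^p` quasinorm. -/
lemma abs_dilConv_le_HpMaxNorm {n m : ℕ} {p : ℝ} (hp0 : 0 < p) (hp1 : p < 1)
    (hm : (n : ℝ) / p < m) (η : ContDiffBump (0 : E n)) (hη : η.rOut = 1) {H : ℝ} (hH : 0 < H)
    (hηH : ∀ j ≤ m, ∀ u, ‖iteratedFDeriv ℝ j η u‖ ≤ H)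
    {R t : ℝ} (hR : 0 < R) (ht : 0 < t) {f : E n → ℝ} (hf : Integrable f)
    (hsupp : ∀ y, y ∉ closedBall (0 : E n) R → f y = 0)
    (hgp : Integrable fun x => grandMaximal n m f x ^ p)
    {φ : SchwartzMap (E n) ℝ} (hφ : MemAm n m φ) {x : E n} (hx : 4 * R < ‖x‖) :
    |dilConv n φ t f x| ≤ 3 ^ m * 2 ^ m * H / (∫ u, η u) *
      ((volume : Measure (E n)).real (ball 0 1)) ^ (-(1 / p - 1)) *
      R ^ (-((n : ℝ) / p)) * HpMaxNorm n m p f := by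
  have hnm : n < m := by
    have : (n : ℝ) ≤ n / p := le_div_self (Nat.cast_nonneg n) hp0 hp1.le
    exact_mod_cast this.trans_lt hm
  set s := min t R with hs
  have hs0 : 0 < s := lt_min ht hR
  have hsR : s ≤ R := min_le_right _ _
  have hst : s ≤ t := min_le_left _ _
  set v := (volume : Measure (E n)).real (ball 0 1)
  have hv0 : 0 < v := ENNReal.toReal_pos (measure_ball_pos _ _ one_pos).ne' measure_ball_lt_top.ne
  have hI : 0 < ∫ u, η u := η.integral_pos
  set L := 3 ^ m * 2 ^ m * H * (s / R) ^ m * s ^ n with hL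
  have hL0 : 0 < L := by positivity
  set N := ∫ z, grandMaximal n m f z ^ p with hN
  have hN0 : 0 ≤ N := integral_nonneg fun z => Real.rpow_nonneg (grandMaximal_nonneg n m f z) p
  have hloc := integral_le_of_le_on_closedBall hp0 hp1 hs0
    (c := fun w => |∫ y, φ (t⁻¹ • (x - y)) * f y * η (s⁻¹ • (w - y))| / L)
    (fun w => by positivity) (grandMaximal_nonneg n m f) hgp (by
      filter_upwards [ae_abs_dilConv_le_grandMaximal hnm hf] with z hz w hzw
      rw [div_le_iff₀' hL0]
      exact abs_integral_localized_le hφ η hη hH hηH hR ht hsupp hx hzw hz)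
  rw [integral_div, div_le_iff₀ hL0] at hloc
  have hmain := (abs_integral_mul_le_integral_abs_localized φ η (t := t) hs0 hf x).trans hloc
  have hdil : |dilConv n φ t f x| = (t ^ n)⁻¹ * |∫ y, φ (t⁻¹ • (x - y)) * f y| := by
    simp only [dilConv, mul_assoc]
    rw [integral_const_mul, abs_mul, abs_of_nonneg (by positivity)]
  have hpow : (N / (s ^ n * v)) ^ (1 / p - 1) * N =
      v ^ (-(1 / p - 1)) * s ^ (-((n : ℝ) / p)) * s ^ n * N ^ (1 / p) := by
    rw [Real.div_rpow hN0 (by positivity), Real.mul_rpow (by positivity) hv0.le,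
      Real.rpow_neg hv0.le]
    have h1 : N ^ (1 / p) = N ^ (1 / p - 1) * N := by
      rcases hN0.eq_or_lt with h0 | h0
      · rw [← h0, mul_zero, Real.zero_rpow (by positivity)]
      · rw [Real.rpow_sub_one h0.ne', div_mul_cancel₀ _ h0.ne']
    have h2 : s ^ (-((n : ℝ) / p)) * s ^ n = ((s ^ n) ^ (1 / p - 1))⁻¹ := by
      rw [← Real.rpow_natCast, ← Real.rpow_mul hs0.le, ← Real.rpow_neg hs0.le,
        ← Real.rpow_add hs0]
      congr 1
      ring
    rw [h1, mul_assoc (v ^ _)⁻¹, h2]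
    field_simp
  have hratio : (s / R) ^ m * s ^ (-((n : ℝ) / p)) ≤ R ^ (-((n : ℝ) / p)) := by
    have h1 : (s / R) ^ (m : ℝ) ≤ (s / R) ^ ((n : ℝ) / p) :=
      Real.rpow_le_rpow_of_exponent_ge (by positivity) ((div_le_one hR).2 hsR) hm.le
    rw [Real.rpow_natCast, Real.div_rpow hs0.le hR.le] at h1
    calc _ ≤ s ^ ((n : ℝ) / p) / R ^ ((n : ℝ) / p) * s ^ (-((n : ℝ) / p)) := by gcongr
      _ = _ := by
        rw [Real.rpow_neg hs0.le, Real.rpow_neg hR.le]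
        field_simp
  rw [hpow, ← le_div_iff₀ (by positivity)] at hmain
  have hHp : HpMaxNorm n m p f = N ^ (1 / p) := rfl
  rw [hdil, hHp]
  calc (t ^ n)⁻¹ * |∫ y, φ (t⁻¹ • (x - y)) * f y|
      ≤ (s ^ n)⁻¹ * (v ^ (-(1 / p - 1)) * s ^ (-((n : ℝ) / p)) * s ^ n * N ^ (1 / p) * L /
          (s ^ n * ∫ u, η u)) := by gcongr
    _ = 3 ^ m * 2 ^ m * H / (∫ u, η u) * v ^ (-(1 / p - 1)) *
          ((s / R) ^ m * s ^ (-((n : ℝ) / p))) * N ^ (1 / p) := by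
        rw [hL]
        field_simp
    _ ≤ _ := by gcongr

/-- **Theorem (decay of the grand maximal function of a compactly supported `H^p`
function).**  Let `n ≥ 1`, `0 < p < 1` and `m > n/p` an integer.  There is a constant
`C > 0` such that for every `R > 0` and every `f ∈ H^p(ℝⁿ) ∩ L¹(ℝⁿ)` supported in
`B̄(0,R)` one has `M_m f(x) ≤ C R^{-n/p} ‖f‖_{H^p}` for every `x` with `|x| > C R`. -/
theorem grand_maximal_decay_Hp (n m : ℕ) (hn : 1 ≤ n) (p : ℝ)
    (hp0 : 0 < p) (hp1 : p < 1) (hm : (n : ℝ) / p < m) :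
    ∃ C : ℝ, 0 < C ∧
      ∀ (R : ℝ), 0 < R → ∀ f : E n → ℝ, Integrable f →
        (∀ y, y ∉ closedBall (0 : E n) R → f y = 0) →
        Integrable (fun x => grandMaximal n m f x ^ p) →
        ∀ x : E n, C * R < ‖x‖ →
          grandMaximal n m f x ≤ C * R ^ (-((n : ℝ) / p)) * HpMaxNorm n m p f := by
  let η : ContDiffBump (0 : E n) := ⟨1 / 2, 1, by norm_num, by norm_num⟩
  obtain ⟨H, hH, hηH⟩ := exists_bound_iteratedFDeriv η m
  set K := 3 ^ m * 2 ^ m * H / (∫ u, η u) *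
    ((volume : Measure (E n)).real (ball 0 1)) ^ (-(1 / p - 1))
  refine ⟨max 4 K, by positivity, fun R hR f hf hsupp hgp x hx => ?_⟩
  have hx4 : 4 * R < ‖x‖ := lt_of_le_of_lt (by gcongr; exact le_max_left _ _) hx
  have hHp : 0 ≤ HpMaxNorm n m p f := Real.rpow_nonneg
    (integral_nonneg fun z => Real.rpow_nonneg (grandMaximal_nonneg n m f z) p) _
  refine Real.sSup_le ?_ (by positivity)
  rintro _ ⟨φ, hφ, t, ht, rfl⟩
  refine (abs_dilConv_le_HpMaxNorm hp0 hp1 hm η rfl hH hηH hR ht hf hsupp hgp hφ hx4).trans ?_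
  gcongr
  exact le_max_right _ _
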